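/- In ℝ[x_1,x_2,x_3] let ℒ₁ = x_2 ∂/∂x_1 + x_3 ∂/∂x_2 + a₂ x_1² ∂/∂x_1 with a₂ ≠ 0 a real number. For every integer l ≥ 3 and every a ∈ ℝ, there exist real numbers α and β such that α·x_1^{l−2}·(x_2 + a₂x_1²) ∂/∂x_1 + [β·x_1^{l−1} ∂/∂x_1, ℒ₁] = a·x_1^{l} ∂/∂x_1. Consequently every term x_1^l ∂/∂x_1 with l > 2 lies in the image of the outer transformation operator ρ applied to ℒ₁, and the first component of the 3D feed forward outer normal form can be reduced to x_2 + a₂x_1². -/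

import Mathlib

open MvPolynomial

/-- A vector field `f ∂/∂x₁` as a derivation of `ℝ[x₁,x₂,x₃]`
(variables `x₁ = X 0`, `x₂ = X 1`, `x₃ = X 2`). -/
noncomputable def vf3 (f : MvPolynomial (Fin 3) ℝ) :
    Derivation ℝ (MvPolynomial (Fin 3) ℝ) (MvPolynomial (Fin 3) ℝ) :=
  MvPolynomial.mkDerivation ℝ (fun v : Fin 3 => if v = 0 then f else 0)

/-- `ℒ₁ = x₂ ∂/∂x₁ + x₃ ∂/∂x₂ + a₂ x₁² ∂/∂x₁` as a derivation of `ℝ[x₁,x₂,x₃]`. -/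
noncomputable def L1 (a₂ : ℝ) :
    Derivation ℝ (MvPolynomial (Fin 3) ℝ) (MvPolynomial (Fin 3) ℝ) :=
  MvPolynomial.mkDerivation ℝ (fun v : Fin 3 =>
    if v = 0 then X (1 : Fin 3) + C a₂ * X (0 : Fin 3) ^ 2
    else if v = 1 then X (2 : Fin 3) else 0)

theorem vf3_X_zero (f : MvPolynomial (Fin 3) ℝ) : vf3 f (X 0) = f := by
  simp [vf3, mkDerivation_X]

theorem vf3_X_of_ne_zero (f : MvPolynomial (Fin 3) ℝ) {i : Fin 3} (hi : i ≠ 0) :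
    vf3 f (X i) = 0 := by
  simp [vf3, mkDerivation_X, hi]

theorem L1_X_zero (a₂ : ℝ) : L1 a₂ (X 0) = X 1 + C a₂ * X 0 ^ 2 := by
  simp [L1, mkDerivation_X]

theorem L1_X_one (a₂ : ℝ) : L1 a₂ (X 1) = X 2 := by
  simp [L1, mkDerivation_X]

theorem L1_X_two (a₂ : ℝ) : L1 a₂ (X 2) = 0 := by
  simp [L1, mkDerivation_X]

/-- The bracket of `g ∂/∂x₁` with `ℒ₁` is again a multiple of `∂/∂x₁`. -/
theorem vf3_lie_L1 (a₂ : ℝ) (g : MvPolynomial (Fin 3) ℝ) :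
    ⁅vf3 g, L1 a₂⁆ = vf3 (2 * C a₂ * X 0 * g - L1 a₂ g) := by
  refine MvPolynomial.derivation_ext fun i => ?_
  rw [Derivation.commutator_apply]
  fin_cases i
  · simp only [Fin.zero_eta, L1_X_zero, vf3_X_zero, map_add, Derivation.leibniz,
      Derivation.leibniz_pow, derivation_C, vf3_X_of_ne_zero g one_ne_zero, smul_eq_mul,
      nsmul_eq_mul]
    push_cast
    ring
  · simp [L1_X_one, vf3_X_of_ne_zero]
  · simp [L1_X_two, vf3_X_of_ne_zero]

theorem vf3_add (f g : MvPolynomial (Fin 3) ℝ) : vf3 f + vf3 g = vf3 (f + g) := by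
  refine MvPolynomial.derivation_ext fun i => ?_
  by_cases hi : i = 0 <;> simp [vf3, mkDerivation_X, hi]

/-- for `a₂ ≠ 0`, `l ≥ 3` and any `a ∈ ℝ` there exist `α, β ∈ ℝ` with
`α·x₁^{l−2}·(x₂ + a₂x₁²) ∂/∂x₁ + [β·x₁^{l−1} ∂/∂x₁, ℒ₁] = a·x₁^l ∂/∂x₁`. -/
theorem outer_elimination_xl_terms_3d (a₂ : ℝ) (ha : a₂ ≠ 0) (l : ℕ) (hl : 3 ≤ l) (a : ℝ) :
    ∃ α β : ℝ,
      vf3 (C α * X (0 : Fin 3) ^ (l - 2) * (X (1 : Fin 3) + C a₂ * X (0 : Fin 3) ^ 2)) +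
        ⁅vf3 (C β * X (0 : Fin 3) ^ (l - 1)), L1 a₂⁆ =
      vf3 (C a * X (0 : Fin 3) ^ l) := by
  obtain ⟨k, rfl⟩ : ∃ k, l = k + 2 := ⟨l - 2, by omega⟩
  refine ⟨a / (2 * a₂) * (k + 1), a / (2 * a₂), ?_⟩
  have hC : (C (a / (2 * a₂)) : MvPolynomial (Fin 3) ℝ) * (2 * C a₂) = C a := by
    rw [← map_ofNat C 2, ← C_mul, ← C_mul, div_mul_cancel₀ _ (by simpa using ha)]
  have h1 : k + 2 - 1 = k + 1 := rfl
  rw [vf3_lie_L1, vf3_add, ← hC, h1, Nat.add_sub_cancel]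
  congr 1
  simp only [Derivation.leibniz, Derivation.leibniz_pow, derivation_C, L1_X_zero, smul_eq_mul,
    nsmul_eq_mul, C_mul, C_add, C_1, map_natCast, Nat.add_sub_cancel]
  push_cast
  ring
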